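/- Let γ > 0 and α > 0 be real, let V be an invertible real N×N matrix, and let λ₁, …, λ_N be real numbers with 0 < λᵢ < γ²/4 for all i; set cᵢ = −γ/2 + √(γ²/4 − λᵢ), dᵢ = −γ/2 − √(γ²/4 − λᵢ), hᵢ(t) = (exp(cᵢ·t) − exp(dᵢ·t))/(cᵢ − dᵢ), and gᵢ = hᵢ'. Define the matrix functions T_ω(τ) = V·diag(g₁(τ), …, g_N(τ))·Vᵀ and C_ω(τ) = α·V·diag(∫₀^∞ g₁(t)g₁(t+τ)dt, …, ∫₀^∞ g_N(t)g_N(t+τ)dt)·Vᵀ for τ ≥ 0. Then, entrywise, C_ω(τ) = (α/(2γ))·T_ω(τ) for every τ ≥ 0. -/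

import Mathlib

open Matrix MeasureTheory

/-- The derivative of a normalized difference of two exponentials. -/
lemma deriv_exp_sub_exp_div (c d t : ℝ) :
    deriv (fun t => (Real.exp (c * t) - Real.exp (d * t)) / (c - d)) t =
      (c * Real.exp (c * t) - d * Real.exp (d * t)) / (c - d) := by
  have key (a : ℝ) : HasDerivAt (fun t => Real.exp (a * t)) (a * Real.exp (a * t)) t := by
    simpa [mul_comm] using ((hasDerivAt_id t).const_mul a).exp
  exact (((key c).sub (key d)).div_const (c - d)).deriv

/-- The autocorrelation on `(0, ∞)` of a normalized combination of two decaying exponentials. -/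
lemma integral_autocorrelation_exp {c d : ℝ} (hc : c < 0) (hd : d < 0) (hcd : c ≠ d) (τ : ℝ) :
    ∫ t in Set.Ioi (0 : ℝ),
        ((c * Real.exp (c * t) - d * Real.exp (d * t)) / (c - d)) *
          ((c * Real.exp (c * (t + τ)) - d * Real.exp (d * (t + τ))) / (c - d)) =
      -1 / (2 * (c + d)) * ((c * Real.exp (c * τ) - d * Real.exp (d * τ)) / (c - d)) := by
  have hsub : c - d ≠ 0 := sub_ne_zero.2 hcd
  have hadd : c + d ≠ 0 := by linarith
  have expand (t : ℝ) :
      ((c * Real.exp (c * t) - d * Real.exp (d * t)) / (c - d)) *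
          ((c * Real.exp (c * (t + τ)) - d * Real.exp (d * (t + τ))) / (c - d)) =
        c ^ 2 * Real.exp (c * τ) / (c - d) ^ 2 * Real.exp ((c + c) * t) -
          c * d * (Real.exp (c * τ) + Real.exp (d * τ)) / (c - d) ^ 2 * Real.exp ((c + d) * t) +
          d ^ 2 * Real.exp (d * τ) / (c - d) ^ 2 * Real.exp ((d + d) * t) := by
    simp only [mul_add, add_mul, Real.exp_add]
    field_simp
    ring
  have int {a : ℝ} (ha : a < 0) (k : ℝ) :
      IntegrableOn (fun t => k * Real.exp (a * t)) (Set.Ioi 0) :=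
    (integrableOn_exp_mul_Ioi ha 0).const_mul k
  have hcc : c + c < 0 := by linarith
  have hcd' : c + d < 0 := by linarith
  have hdd : d + d < 0 := by linarith
  simp_rw [expand]
  rw [integral_add (by exact (int hcc _).sub (int hcd' _)) (int hdd _),
    integral_sub (int hcc _) (int hcd' _)]
  simp only [integral_const_mul]
  rw [integral_exp_mul_Ioi hcc, integral_exp_mul_Ioi hcd', integral_exp_mul_Ioi hdd]
  have hc0 := hc.ne
  have hd0 := hd.ne
  simp only [mul_zero, Real.exp_zero, ← two_mul]
  field_simp
  ring

/-- Matrix form of Lemma 1 (Frequency Response): with `T_ω(τ) = V diag(gᵢ(τ)) Vᵀ` and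
`C_ω(τ) = α · V diag(∫₀^∞ gᵢ(t)gᵢ(t+τ)dt) Vᵀ`, where `gᵢ = hᵢ'`, one has
`C_ω(τ) = (α/(2γ)) T_ω(τ)` entrywise for every `τ ≥ 0`. -/
theorem frequency_response_matrix_form
    (N : ℕ) (γ α : ℝ) (hγ : 0 < γ) (hα : 0 < α)
    (V : Matrix (Fin N) (Fin N) ℝ) (hV : IsUnit V)
    (lam : Fin N → ℝ) (hlam : ∀ i, 0 < lam i ∧ lam i < γ ^ 2 / 4)
    (c d : Fin N → ℝ)
    (hc : ∀ i, c i = -γ / 2 + Real.sqrt (γ ^ 2 / 4 - lam i))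
    (hd : ∀ i, d i = -γ / 2 - Real.sqrt (γ ^ 2 / 4 - lam i))
    (h : Fin N → ℝ → ℝ)
    (hh : ∀ i, h i = fun t =>
      (Real.exp (c i * t) - Real.exp (d i * t)) / (c i - d i))
    (g : Fin N → ℝ → ℝ) (hg : ∀ i, g i = deriv (h i))
    (Tω Cω : ℝ → Matrix (Fin N) (Fin N) ℝ)
    (hTω : ∀ τ : ℝ, Tω τ = V * Matrix.diagonal (fun i => g i τ) * Vᵀ)
    (hCω : ∀ τ : ℝ, 0 ≤ τ → Cω τ = α •
      (V * Matrix.diagonal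
        (fun i => ∫ t in Set.Ioi (0 : ℝ), g i t * g i (t + τ)) * Vᵀ)) :
    ∀ τ : ℝ, 0 ≤ τ → Cω τ = (α / (2 * γ)) • Tω τ := by
  intro τ hτ
  have hgi (i : Fin N) (t : ℝ) :
      g i t = (c i * Real.exp (c i * t) - d i * Real.exp (d i * t)) / (c i - d i) := by
    rw [hg, hh, deriv_exp_sub_exp_div]
  have hint (i : Fin N) :
      ∫ t in Set.Ioi (0 : ℝ), g i t * g i (t + τ) = 1 / (2 * γ) * g i τ := by
    obtain ⟨hpos, hlt⟩ := hlam i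
    have hs : 0 < Real.sqrt (γ ^ 2 / 4 - lam i) := Real.sqrt_pos.2 (by linarith)
    have hs' : Real.sqrt (γ ^ 2 / 4 - lam i) < γ / 2 := by
      rw [Real.sqrt_lt' (by linarith)]
      nlinarith
    have hneg : c i < 0 := by rw [hc]; linarith
    have hneg' : d i < 0 := by rw [hd]; linarith
    have hne : c i ≠ d i := by
      rw [hc, hd]
      intro h
      linarith
    have hadd : c i + d i = -γ := by rw [hc, hd]; ring
    simp_rw [hgi]
    rw [integral_autocorrelation_exp hneg hneg' hne, hadd]
    congr 1
    field_simp
  have hdiag : Matrix.diagonal (fun i => ∫ t in Set.Ioi (0 : ℝ), g i t * g i (t + τ)) =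
      (1 / (2 * γ)) • Matrix.diagonal (fun i => g i τ) := by
    simp_rw [hint]
    rw [← Matrix.diagonal_smul]
    rfl
  rw [hCω τ hτ, hTω, hdiag, Matrix.mul_smul, Matrix.smul_mul, smul_smul]
  congr 1
  ring
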